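/- arXiv:1106.1638 — 3 statements merged into one kernel-verified Lean document; each statement's English description precedes it below -/
import Mathlib

section
/- Let k ≥ 2, let Y be a standard normal random variable, and for i = 1, …, k let F_i(y) = Φ(y/√(i+1)) be the cumulative distribution function of the normal distribution with mean 0 and variance i+1, where Φ is the standard normal cumulative distribution function. Then for all nonnegative weights w₁, …, w_k summing to 1, Var(Σ_{i=1}^k w_i F_i(Y)) < 1/12. -/
open MeasureTheory ProbabilityTheory

/-- The standard normal cumulative distribution function `Φ`. -/
noncomputable def stdNormalCDF (x : ℝ) : ℝ :=
  (ProbabilityTheory.gaussianReal 0 1 (Set.Iic x)).toReal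

open Filter Topology in
lemma Phi_aux : (∀ x, HasDerivAt stdNormalCDF (gaussianPDFReal 0 1 x) x) ∧
    Tendsto stdNormalCDF atBot (𝓝 0) ∧ Tendsto stdNormalCDF atTop (𝓝 1) ∧
    stdNormalCDF 0 = 1 / 2 := by
  have hc : stdNormalCDF = cdf (gaussianReal 0 1) := by
    ext x; rw [cdf_eq_real]; rfl
  have hcont : Continuous (gaussianPDFReal 0 1) := by
    unfold gaussianPDFReal; fun_prop
  have hint := integrable_gaussianPDFReal 0 1
  have hI : ∀ x, stdNormalCDF x = ∫ t in Set.Iic x, gaussianPDFReal 0 1 t := by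
    intro x
    unfold stdNormalCDF
    rw [gaussianReal_apply_eq_integral 0 one_ne_zero, ENNReal.toReal_ofReal]
    exact integral_nonneg fun t => gaussianPDFReal_nonneg 0 1 t
  refine ⟨?_, ?_, ?_, ?_⟩
  · intro x
    have h : stdNormalCDF = fun x => (∫ t in (0:ℝ)..x, gaussianPDFReal 0 1 t) + stdNormalCDF 0 := by
      ext x
      rw [← intervalIntegral.integral_Iic_sub_Iic hint.integrableOn hint.integrableOn, hI, hI]
      ring
    rw [h]
    apply HasDerivAt.add_const
    exact intervalIntegral.integral_hasDerivAt_right (hcont.intervalIntegrable _ _)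
      (hcont.stronglyMeasurableAtFilter _ _) hcont.continuousAt
  · rw [hc]; exact tendsto_cdf_atBot _
  · rw [hc]; exact tendsto_cdf_atTop _
  · have hna : NullSingletonClass (gaussianReal 0 1) := nullSingletonClass_gaussianReal one_ne_zero
    have h1 : (gaussianReal 0 1).real (Set.Iic 0) = (gaussianReal 0 1).real (Set.Ioi 0) := by
      have h := gaussianReal_map_neg (μ := 0) (v := 1)
      rw [neg_zero] at h
      conv_lhs => rw [← h]
      rw [map_measureReal_apply (by fun_prop) measurableSet_Iic]
      have : (fun x : ℝ => -x) ⁻¹' Set.Iic 0 = Set.Ici 0 := by ext; simp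
      rw [this]
      exact measureReal_congr Ioi_ae_eq_Ici.symm
    have h2 := probReal_add_probReal_compl (μ := gaussianReal 0 1) (measurableSet_Iic (a := (0:ℝ)))
    rw [Set.compl_Iic, ← h1] at h2
    change (gaussianReal 0 1).real (Set.Iic 0) = _
    linarith

lemma Phi_strictMono : StrictMono stdNormalCDF :=
  strictMono_of_deriv_pos fun x => by
    rw [(Phi_aux.1 x).deriv]; exact gaussianPDFReal_pos 0 1 x one_ne_zero

lemma Phi_bd (x : ℝ) : 0 ≤ stdNormalCDF x ∧ stdNormalCDF x ≤ 1 :=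
  ⟨ENNReal.toReal_nonneg, measureReal_le_one⟩

lemma Phi_int : ∫ y, (stdNormalCDF y - 1/2) ^ 2 ∂(gaussianReal 0 1) = 1 / 12 := by
  obtain ⟨hd, hb, ht, -⟩ := Phi_aux
  have hcont : Continuous stdNormalCDF :=
    continuous_iff_continuousAt.2 fun x => (hd x).continuousAt
  rw [integral_gaussianReal_eq_integral_smul one_ne_zero]
  have := integral_of_hasDerivAt_of_tendsto (f := fun y => (stdNormalCDF y - 1/2) ^ 3 / 3)
    (f' := fun y => gaussianPDFReal 0 1 y • (stdNormalCDF y - 1/2) ^ 2)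
    (m := (0 - 1/2) ^ 3 / 3) (n := (1 - 1/2) ^ 3 / 3) ?_ ?_ ?_ ?_
  · rw [this]; norm_num
  · intro x
    refine ((((hd x).sub_const (1/2)).pow 3).div_const 3).congr_deriv ?_
    simp only [smul_eq_mul]; push_cast; ring
  · refine (integrable_gaussianPDFReal 0 1).mul_bdd (c := 1) (by fun_prop) (ae_of_all _ fun x => ?_)
    obtain ⟨h0, h1⟩ := Phi_bd x
    rw [Real.norm_eq_abs, abs_le]; constructor <;> nlinarith
  · exact ((hb.sub_const _).pow 3).div_const 3
  · exact ((ht.sub_const _).pow 3).div_const 3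

lemma Phi_shrink (s : ℝ) (hs : 1 < s) (y : ℝ) (hy : y ≠ 0) :
    |stdNormalCDF (y / s) - 1/2| < |stdNormalCDF y - 1/2| := by
  have h0 := Phi_aux.2.2.2
  have hs0 : 0 < s := by linarith
  rcases lt_or_gt_of_ne hy with h | h
  · have a := Phi_strictMono (show y < y / s by rw [lt_div_iff₀ hs0]; nlinarith)
    have b := Phi_strictMono (show y / s < 0 from div_neg_of_neg_of_pos h hs0)
    rw [abs_of_neg (by linarith), abs_of_neg (by linarith)]; linarith
  · have a := Phi_strictMono (show y / s < y by rw [div_lt_iff₀ hs0]; nlinarith)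
    have b := Phi_strictMono (show 0 < y / s from div_pos h hs0)
    rw [abs_of_pos (by linarith), abs_of_pos (by linarith)]; linarith

/-- With a standard normal observation `Y` and components
`F_i = N(0, i+1)` for `i = 1, …, k` (so `F_i(y) = Φ(y/√(i+1))`), every linear pool with
nonnegative weights summing to one has PIT variance strictly below `1/12`, i.e., is
overdispersed; this witnesses that the traditional linear pool fails to be flexibly
dispersive (Theorem 5 of Gneiting–Ranjan). -/
theorem linear_pool_not_flexibly_dispersive
    {Ω : Type*} [MeasurableSpace Ω] (Q : Measure Ω) [IsProbabilityMeasure Q]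
    (k : ℕ) (hk : 2 ≤ k) (Y : Ω → ℝ) (hY : Measurable Y)
    (hYlaw : Q.map Y = gaussianReal 0 1)
    (w : Fin k → ℝ) (hw : ∀ i, 0 ≤ w i) (hw1 : ∑ i, w i = 1) :
    variance (fun ω => ∑ i : Fin k, w i * stdNormalCDF (Y ω / Real.sqrt ((i : ℕ) + 2))) Q
      < 1 / 12 := by
  have hcont : Continuous stdNormalCDF :=
    continuous_iff_continuousAt.2 fun x => (Phi_aux.1 x).continuousAt
  set G : ℝ → ℝ := fun y => ∑ i : Fin k, w i * stdNormalCDF (y / Real.sqrt ((i : ℕ) + 2)) with hG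
  have hGc : Continuous G := by rw [hG]; fun_prop
  have hs : ∀ i : Fin k, 1 < Real.sqrt ((i : ℕ) + 2) := fun i => by
    rw [Real.lt_sqrt (by norm_num)]
    have : (0:ℝ) ≤ (i : ℕ) := Nat.cast_nonneg _
    linarith
  have hGsub : ∀ y, G y - 1/2
      = ∑ i : Fin k, w i * (stdNormalCDF (y / Real.sqrt ((i : ℕ) + 2)) - 1/2) := fun y => by
    simp only [hG, mul_sub, Finset.sum_sub_distrib, ← Finset.sum_mul, hw1, one_mul]
  have hlt : ∀ y, y ≠ 0 → |G y - 1/2| < |stdNormalCDF y - 1/2| := fun y hy => by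
    rw [hGsub]
    refine (Finset.abs_sum_le_sum_abs _ _).trans_lt ?_
    have : |stdNormalCDF y - 1/2| = ∑ i : Fin k, w i * |stdNormalCDF y - 1/2| := by
      rw [← Finset.sum_mul, hw1, one_mul]
    rw [this]
    obtain ⟨j, -, hj⟩ : ∃ j ∈ Finset.univ, w j ≠ 0 :=
      Finset.exists_ne_zero_of_sum_ne_zero (by rw [hw1]; exact one_ne_zero)
    apply Finset.sum_lt_sum
    · intro i _
      rw [abs_mul, abs_of_nonneg (hw i)]
      exact mul_le_mul_of_nonneg_left (Phi_shrink _ (hs i) y hy).le (hw i)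
    · refine ⟨j, Finset.mem_univ _, ?_⟩
      rw [abs_mul, abs_of_nonneg (hw j)]
      exact mul_lt_mul_of_pos_left (Phi_shrink _ (hs j) y hy) ((hw j).lt_of_ne' hj)
  have hsq : ∀ y, y ≠ 0 → (G y - 1/2) ^ 2 < (stdNormalCDF y - 1/2) ^ 2 :=
    fun y hy => sq_lt_sq.2 (hlt y hy)
  have hna : NullSingletonClass (gaussianReal 0 1) := nullSingletonClass_gaussianReal one_ne_zero
  have hae : ∀ᵐ y ∂(gaussianReal 0 1), y ≠ 0 := by
    rw [ae_iff]; simp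
  have hΦi : Integrable (fun y => (stdNormalCDF y - 1/2) ^ 2) (gaussianReal 0 1) := by
    refine Integrable.of_bound (by fun_prop) 1 (ae_of_all _ fun x => ?_)
    obtain ⟨h0, h1⟩ := Phi_bd x
    rw [Real.norm_eq_abs, abs_le]; constructor <;> nlinarith
  have hGi : Integrable (fun y => (G y - 1/2) ^ 2) (gaussianReal 0 1) := by
    refine hΦi.mono (by fun_prop) ?_
    filter_upwards [hae] with y hy
    rw [Real.norm_of_nonneg (sq_nonneg _), Real.norm_of_nonneg (sq_nonneg _)]
    exact (hsq y hy).le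
  have hmain : ∫ y, (G y - 1/2) ^ 2 ∂(gaussianReal 0 1) < 1 / 12 := by
    rw [← Phi_int]
    rw [← sub_pos, ← integral_sub hΦi hGi]
    refine (integral_pos_iff_support_of_nonneg_ae ?_ (hΦi.sub hGi)).2 ?_
    rotate_left
    · rw [pos_iff_ne_zero]
      intro h
      have h3 : ∀ᵐ y ∂(gaussianReal 0 1),
          y ∉ Function.support fun y => (stdNormalCDF y - 1/2) ^ 2 - (G y - 1/2) ^ 2 :=
        measure_eq_zero_iff_ae_notMem.1 h
      obtain ⟨y, hy, hy'⟩ := (hae.and h3).exists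
      exact hy' (sub_pos.2 (hsq y hy)).ne'
    · filter_upwards [hae] with y hy using sub_nonneg.2 (hsq y hy).le
  have hYm : AEStronglyMeasurable (fun ω => G (Y ω)) Q :=
    (hGc.measurable.comp hY).aestronglyMeasurable
  calc variance (fun ω => G (Y ω)) Q
      = variance (fun ω => G (Y ω) - 1/2) Q := (variance_sub_const hYm _).symm
    _ ≤ ∫ ω, (G (Y ω) - 1/2) ^ 2 ∂Q :=
        variance_le_expectation_sq (hYm.sub aestronglyMeasurable_const)
    _ = ∫ y, (G y - 1/2) ^ 2 ∂(gaussianReal 0 1) := by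
        rw [← hYlaw, integral_map hY.aemeasurable]
        fun_prop
    _ < 1 / 12 := hmain
end

section
/- Let I ⊆ ℝ be an interval, let k ≥ 1, and let F₀, F₁, …, F_k be continuous cumulative distribution functions on ℝ that are supported in I and strictly increasing on I. Let Y be a random variable with law F₀. Then there exist α > 0 and β > 0 such that, with equal weights w₁ = ⋯ = w_k = 1/k, the random variable Z_{α,β} = B_{α,β}((1/k)·Σ_{i=1}^k F_i(Y)) satisfies Var(Z_{α,β}) = 1/12, where B_{α,β} denotes the cumulative distribution function of the Beta distribution with parameters α and β. -/
open MeasureTheory ProbabilityTheory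

/-- The cumulative distribution function of a Borel measure on `ℝ`. -/
noncomputable def cdfOf (μ : Measure ℝ) : ℝ → ℝ :=
  fun y => (μ (Set.Iic y)).toReal

/-- The cumulative distribution function `B_{a,b}` of the Beta distribution with
parameters `a, b > 0`. -/
noncomputable def betaCDF (a b x : ℝ) : ℝ :=
  (∫ t in Set.Ioc (0 : ℝ) (min x 1), t ^ (a - 1) * (1 - t) ^ (b - 1)) /
    ∫ t in Set.Ioc (0 : ℝ) 1, t ^ (a - 1) * (1 - t) ^ (b - 1)

open Filter Topology

lemma blp_cont {a b : ℝ} (ha : 1 ≤ a) (hb : 1 ≤ b) :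
    Continuous (fun t : ℝ => t ^ (a - 1) * (1 - t) ^ (b - 1)) := by
  have h1 : Continuous (fun t : ℝ => t ^ (a - 1)) :=
    Real.continuous_rpow_const (by linarith)
  have h2 : Continuous (fun t : ℝ => (1 - t) ^ (b - 1)) :=
    (Real.continuous_rpow_const (by linarith)).comp (continuous_const.sub continuous_id)
  exact h1.mul h2

lemma blp_nonneg {a b t : ℝ} (h0 : 0 ≤ t) (h1 : t ≤ 1) :
    0 ≤ t ^ (a - 1) * (1 - t) ^ (b - 1) :=
  mul_nonneg (Real.rpow_nonneg h0 _) (Real.rpow_nonneg (by linarith) _)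

lemma blp_le_one {a b t : ℝ} (ha : 1 ≤ a) (hb : 1 ≤ b) (h0 : 0 ≤ t) (h1 : t ≤ 1) :
    t ^ (a - 1) * (1 - t) ^ (b - 1) ≤ 1 :=
  mul_le_one₀ (Real.rpow_le_one h0 h1 (by linarith)) (Real.rpow_nonneg (by linarith) _)
    (Real.rpow_le_one (by linarith) (by linarith) (by linarith))

lemma blp_int {a b : ℝ} (ha : 1 ≤ a) (hb : 1 ≤ b) (x : ℝ) :
    IntegrableOn (fun t : ℝ => t ^ (a - 1) * (1 - t) ^ (b - 1)) (Set.Ioc 0 x) :=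
  ((blp_cont ha hb).integrableOn_Icc).mono_set Set.Ioc_subset_Icc_self

lemma blp_den_pos {a b : ℝ} (ha : 1 ≤ a) (hb : 1 ≤ b) :
    0 < ∫ t in Set.Ioc (0 : ℝ) 1, t ^ (a - 1) * (1 - t) ^ (b - 1) := by
  rw [← intervalIntegral.integral_of_le zero_le_one]
  apply intervalIntegral.intervalIntegral_pos_of_pos_on
  · exact (blp_cont ha hb).intervalIntegrable _ _
  · intro t ht
    exact mul_pos (Real.rpow_pos_of_pos ht.1 _) (Real.rpow_pos_of_pos (by linarith [ht.2]) _)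
  · exact zero_lt_one

lemma blp_num_mono {a b : ℝ} (ha : 1 ≤ a) (hb : 1 ≤ b) {x y : ℝ} (hxy : x ≤ y) (hy : y ≤ 1) :
    ∫ t in Set.Ioc (0 : ℝ) x, t ^ (a - 1) * (1 - t) ^ (b - 1) ≤
    ∫ t in Set.Ioc (0 : ℝ) y, t ^ (a - 1) * (1 - t) ^ (b - 1) := by
  apply setIntegral_mono_set (blp_int ha hb y)
  · filter_upwards [ae_restrict_mem measurableSet_Ioc] with t ht
    exact blp_nonneg ht.1.le (ht.2.trans hy)
  · exact (Set.Ioc_subset_Ioc_right hxy).eventuallyLE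

lemma blp_mono {a b : ℝ} (ha : 1 ≤ a) (hb : 1 ≤ b) : Monotone (betaCDF a b) := by
  intro x y hxy
  unfold betaCDF
  exact div_le_div_of_nonneg_right
    (blp_num_mono ha hb (min_le_min_right _ hxy) (min_le_right _ _)) (blp_den_pos ha hb).le

lemma blp_mem {a b : ℝ} (ha : 1 ≤ a) (hb : 1 ≤ b) (x : ℝ) : ‖betaCDF a b x‖ ≤ 1 := by
  have h0 : 0 ≤ betaCDF a b x := by
    unfold betaCDF
    refine div_nonneg (setIntegral_nonneg measurableSet_Ioc fun t ht => ?_) (blp_den_pos ha hb).le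
    exact blp_nonneg ht.1.le (ht.2.trans (min_le_right _ _))
  rw [Real.norm_of_nonneg h0]
  unfold betaCDF
  exact div_le_one_of_le₀ (blp_num_mono ha hb (min_le_right _ _) le_rfl) (blp_den_pos ha hb).le

/-- continuity in the parameters -/
lemma blp_num_contOn {y : ℝ} (hy : y ≤ 1) :
    ContinuousOn (fun p : ℝ × ℝ => ∫ t in Set.Ioc (0 : ℝ) y, t ^ (p.1 - 1) * (1 - t) ^ (p.2 - 1))
      (Set.Ici 1 ×ˢ Set.Ici 1) := by
  apply continuousOn_of_dominated (bound := fun _ => 1)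
  · intro p hp
    exact (blp_cont hp.1 hp.2).aestronglyMeasurable
  · intro p hp
    filter_upwards [ae_restrict_mem measurableSet_Ioc] with t ht
    rw [Real.norm_of_nonneg (blp_nonneg ht.1.le (ht.2.trans hy))]
    exact blp_le_one hp.1 hp.2 ht.1.le (ht.2.trans hy)
  · exact integrable_const _
  · have h1 : ∀ᵐ t ∂(volume.restrict (Set.Ioc (0:ℝ) y)), t ≠ 1 :=
      ae_restrict_of_ae (by simp [ae_iff])
    filter_upwards [ae_restrict_mem measurableSet_Ioc, h1] with t ht ht1
    have ht1' : 1 - t ≠ 0 := fun h => ht1 (by linarith)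
    apply Continuous.continuousOn
    exact (continuous_const.rpow (continuous_fst.sub continuous_const)
      (fun _ => Or.inl ht.1.ne')).mul (continuous_const.rpow (continuous_snd.sub continuous_const)
      (fun _ => Or.inl ht1'))

lemma blp_contOn (x : ℝ) :
    ContinuousOn (fun p : ℝ × ℝ => betaCDF p.1 p.2 x) (Set.Ici 1 ×ˢ Set.Ici 1) := by
  unfold betaCDF
  exact (blp_num_contOn (min_le_right _ _)).div (blp_num_contOn le_rfl)
    (fun p hp => (blp_den_pos hp.1 hp.2).ne')

lemma blp_var {Ω : Type*} [MeasurableSpace Ω] (Q : Measure Ω) [IsProbabilityMeasure Q]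
    {X : Ω → ℝ} (hX : Measurable X) {a b : ℝ} (ha : 1 ≤ a) (hb : 1 ≤ b) :
    variance (fun ω => betaCDF a b (X ω)) Q =
      ∫ ω, betaCDF a b (X ω) ^ 2 ∂Q - (∫ ω, betaCDF a b (X ω) ∂Q) ^ 2 := by
  have hm : Measurable (fun ω => betaCDF a b (X ω)) := (blp_mono ha hb).measurable.comp hX
  rw [variance_eq_sub]
  · rfl
  · exact MemLp.of_bound hm.aestronglyMeasurable 1 (ae_of_all _ fun ω => blp_mem ha hb _)

lemma blp_var_contOn {Ω : Type*} [MeasurableSpace Ω] (Q : Measure Ω) [IsProbabilityMeasure Q]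
    {X : Ω → ℝ} (hX : Measurable X) :
    ContinuousOn (fun p : ℝ × ℝ => variance (fun ω => betaCDF p.1 p.2 (X ω)) Q)
      (Set.Ici 1 ×ˢ Set.Ici 1) := by
  have hc : ContinuousOn (fun p : ℝ × ℝ => ∫ ω, betaCDF p.1 p.2 (X ω) ^ 2 ∂Q -
      (∫ ω, betaCDF p.1 p.2 (X ω) ∂Q) ^ 2) (Set.Ici 1 ×ˢ Set.Ici 1) := by
    apply ContinuousOn.sub
    · apply continuousOn_of_dominated (bound := fun _ => 1)
      · intro p hp
        exact (((blp_mono hp.1 hp.2).measurable.comp hX).pow_const 2).aestronglyMeasurable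
      · intro p hp
        refine ae_of_all _ fun ω => ?_
        rw [norm_pow]
        exact pow_le_one₀ (norm_nonneg _) (blp_mem hp.1 hp.2 _)
      · exact integrable_const _
      · exact ae_of_all _ fun ω => (blp_contOn (X ω)).pow 2
    · apply ContinuousOn.pow
      apply continuousOn_of_dominated (bound := fun _ => 1)
      · intro p hp
        exact ((blp_mono hp.1 hp.2).measurable.comp hX).aestronglyMeasurable
      · intro p hp
        exact ae_of_all _ fun ω => blp_mem hp.1 hp.2 _
      · exact integrable_const _
      · exact ae_of_all _ fun ω => blp_contOn (X ω)
  exact hc.congr fun p hp => blp_var Q hX hp.1 hp.2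

lemma blp_peak {m : ℝ} (hm0 : 0 < m) (hm1 : m ≤ 1) {t : ℝ} (ht : t ∈ Set.Icc (0:ℝ) 1)
    (htm : t ≠ m) : t ^ m * (1 - t) ^ (1 - m) < m ^ m * (1 - m) ^ (1 - m) := by
  rcases hm1.lt_or_eq with h | rfl
  · have hm' : 0 < 1 - m := by linarith
    have ht' : 0 ≤ 1 - t := by linarith [ht.2]
    have key := (Real.geom_mean_lt_arith_mean2_weighted_iff_of_pos (p₁ := t / m)
      (p₂ := (1 - t) / (1 - m)) hm0 hm' (div_nonneg ht.1 hm0.le) (div_nonneg ht' hm'.le)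
      (by ring)).2 (by
        intro h
        rw [div_eq_div_iff hm0.ne' hm'.ne'] at h
        exact htm (by linarith))
    rw [Real.div_rpow ht.1 hm0.le, Real.div_rpow ht' hm'.le, mul_div_cancel₀ _ hm0.ne',
      mul_div_cancel₀ _ hm'.ne', div_mul_div_comm, add_sub_cancel, div_lt_one] at key
    · exact key
    · exact mul_pos (Real.rpow_pos_of_pos hm0 _) (Real.rpow_pos_of_pos hm' _)
  · simpa using lt_of_le_of_ne ht.2 htm

lemma blp_tendsto {m : ℝ} (hm0 : 0 < m) (hm1 : m ≤ 1) {x : ℝ} (hx : x ∈ Set.Icc (0:ℝ) 1)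
    (hxm : x ≠ m) :
    Tendsto (fun n : ℕ => betaCDF (n * m + 1) (n * (1 - m) + 1) x) atTop
      (𝓝 ((Set.Ioi m).indicator 1 x)) := by
  have hm' : 0 ≤ 1 - m := by linarith
  have key := tendsto_setIntegral_pow_smul_of_unique_maximum_of_isCompact_of_integrableOn
    (μ := (volume : Measure ℝ)) (s := Set.Icc (0:ℝ) 1) (x₀ := m) isCompact_Icc
    (c := fun t => t ^ m * (1 - t) ^ (1 - m)) (g := (Set.Iic x).indicator (fun _ => (1:ℝ)))
    (by
      have := blp_cont (a := m + 1) (b := 1 - m + 1) (by linarith) (by linarith)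
      simpa using this.continuousOn)
    (fun y hy hym => blp_peak hm0 hm1 hy hym)
    (fun t ht => mul_nonneg (Real.rpow_nonneg ht.1 _) (Real.rpow_nonneg (by linarith [ht.2]) _))
    (by
      rcases hm1.lt_or_eq with h | rfl
      · exact mul_pos (Real.rpow_pos_of_pos hm0 _) (Real.rpow_pos_of_pos (by linarith) _)
      · simp)
    (by
      rw [interior_Icc, closure_Ioo zero_ne_one]
      exact ⟨hm0.le, hm1⟩)
    ((integrable_const _).indicator measurableSet_Iic)
    (by
      apply ContinuousAt.continuousWithinAt
      rcases hxm.lt_or_gt with h | h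
      · refine (continuousAt_const (y := (0:ℝ))).congr ?_
        filter_upwards [Ioi_mem_nhds h] with t ht
        have : t ∉ Set.Iic x := fun h' => absurd (Set.mem_Ioi.1 ht) (not_lt.2 (Set.mem_Iic.1 h'))
        simp [this]
      · refine (continuousAt_const (y := (1:ℝ))).congr ?_
        filter_upwards [Iio_mem_nhds h] with t ht
        have : t ∈ Set.Iic x := Set.mem_Iic.2 (le_of_lt (Set.mem_Iio.1 ht))
        simp [this])
  have hval : (Set.Iic x).indicator (fun _ => (1:ℝ)) m = (Set.Ioi m).indicator 1 x := by
    rcases hxm.lt_or_gt with h | h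
    · simp [Set.indicator, h, not_lt.2 h.le]
    · simp [Set.indicator, h, h.le]
  rw [hval] at key
  refine key.congr fun n => ?_
  have hpow : ∀ t ∈ Set.Icc (0:ℝ) 1, (t ^ m * (1 - t) ^ (1 - m)) ^ n =
      t ^ ((n * m + 1 : ℝ) - 1) * (1 - t) ^ ((n * (1 - m) + 1 : ℝ) - 1) := by
    intro t ht
    have ht' : 0 ≤ 1 - t := by linarith [ht.2]
    rw [mul_pow, ← Real.rpow_mul_natCast ht.1, ← Real.rpow_mul_natCast ht']
    congr 2 <;> ring
  unfold betaCDF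
  rw [div_eq_inv_mul, smul_eq_mul]
  congr 1
  · congr 1
    rw [integral_Icc_eq_integral_Ioc]
    exact setIntegral_congr_fun measurableSet_Ioc
      fun t ht => hpow t (Set.Ioc_subset_Icc_self ht)
  · have : ∀ t, (t ^ m * (1 - t) ^ (1 - m)) ^ n • (Set.Iic x).indicator (fun _ => (1:ℝ)) t =
      (Set.Iic x).indicator (fun t => (t ^ m * (1 - t) ^ (1 - m)) ^ n) t := by
      intro t
      by_cases h : t ∈ Set.Iic x <;> simp [h]
    simp_rw [this]
    rw [integral_Icc_eq_integral_Ioc, setIntegral_indicator measurableSet_Iic,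
      Set.Ioc_inter_Iic, min_comm]
    exact setIntegral_congr_fun measurableSet_Ioc
      fun t ht => hpow t ⟨ht.1.le, ht.2.trans (min_le_right _ _)⟩

lemma blp_var_tendsto {Ω : Type*} [MeasurableSpace Ω] (Q : Measure Ω) [IsProbabilityMeasure Q]
    {X : Ω → ℝ} (hX : Measurable X) (hX01 : ∀ ω, X ω ∈ Set.Icc (0:ℝ) 1)
    {m : ℝ} (hm0 : 0 < m) (hm1 : m ≤ 1) (hne : ∀ᵐ ω ∂Q, X ω ≠ m) :
    Tendsto (fun n : ℕ => variance (fun ω => betaCDF (n * m + 1) (n * (1 - m) + 1) (X ω)) Q) atTop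
      (𝓝 (Q.real {ω | m < X ω} - Q.real {ω | m < X ω} ^ 2)) := by
  have hm' : 0 ≤ 1 - m := by linarith
  have ha : ∀ n : ℕ, (1:ℝ) ≤ n * m + 1 := fun n => by
    have : 0 ≤ (n:ℝ) * m := by positivity
    linarith
  have hb : ∀ n : ℕ, (1:ℝ) ≤ n * (1 - m) + 1 := fun n => by
    have : 0 ≤ (n:ℝ) * (1 - m) := by positivity
    linarith
  have hS : MeasurableSet {ω | m < X ω} := measurableSet_lt measurable_const hX
  have hind : ∫ ω, (Set.Ioi m).indicator (1 : ℝ → ℝ) (X ω) ∂Q = Q.real {ω | m < X ω} := by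
    rw [← integral_indicator_one hS]
    rfl
  have hind2 : ∫ ω, ((Set.Ioi m).indicator (1 : ℝ → ℝ) (X ω)) ^ 2 ∂Q = Q.real {ω | m < X ω} := by
    rw [← hind]
    congr 1
    ext ω
    by_cases h : X ω ∈ Set.Ioi m <;> simp [h]
  simp_rw [fun n => blp_var Q hX (ha n) (hb n)]
  apply Tendsto.sub
  · rw [← hind2]
    apply tendsto_integral_of_dominated_convergence (fun _ => 1)
    · intro n
      exact (((blp_mono (ha n) (hb n)).measurable.comp hX).pow_const 2).aestronglyMeasurable
    · exact integrable_const _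
    · intro n
      refine ae_of_all _ fun ω => ?_
      rw [norm_pow]
      exact pow_le_one₀ (norm_nonneg _) (blp_mem (ha n) (hb n) _)
    · filter_upwards [hne] with ω hω
      exact (blp_tendsto hm0 hm1 (hX01 ω) hω).pow 2
  · apply Tendsto.pow
    rw [← hind]
    apply tendsto_integral_of_dominated_convergence (fun _ => 1)
    · intro n
      exact ((blp_mono (ha n) (hb n)).measurable.comp hX).aestronglyMeasurable
    · exact integrable_const _
    · intro n
      exact ae_of_all _ fun ω => blp_mem (ha n) (hb n) _
    · filter_upwards [hne] with ω hω
      exact blp_tendsto hm0 hm1 (hX01 ω) hω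

lemma blp_core {Ω : Type*} [MeasurableSpace Ω] (Q : Measure Ω) [IsProbabilityMeasure Q]
    {X : Ω → ℝ} (hX : Measurable X) (hX01 : ∀ ω, X ω ∈ Set.Icc (0:ℝ) 1)
    (hatom : ∀ c, ∀ᵐ ω ∂Q, X ω ≠ c)
    {m : ℝ} (hm0 : 0 < m) (hm1 : m ≤ 1) (hhalf : Q.real {ω | m < X ω} = 1 / 2) :
    ∃ a b : ℝ, 0 < a ∧ 0 < b ∧ variance (fun ω => betaCDF a b (X ω)) Q = 1 / 12 := by
  have hmem : ∀ (c : ℝ), 0 < c → c ≤ 1 → ∀ n : ℕ,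
      ((n * c + 1, n * (1 - c) + 1) : ℝ × ℝ) ∈ (Set.Ici 1 ×ˢ Set.Ici 1 : Set (ℝ × ℝ)) := by
    intro c h0 h1 n
    have h1' : 0 ≤ 1 - c := by linarith
    have e1 : 0 ≤ (n:ℝ) * c := by positivity
    have e2 : 0 ≤ (n:ℝ) * (1 - c) := by positivity
    exact ⟨by simpa using e1, by simpa using e2⟩
  have hbig := blp_var_tendsto Q hX hX01 hm0 hm1 (hatom m)
  rw [hhalf] at hbig
  have hsmall := blp_var_tendsto Q hX hX01 zero_lt_one le_rfl (hatom 1)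
  have hz : {ω | 1 < X ω} = ∅ := by
    ext ω
    simpa using (hX01 ω).2
  rw [hz] at hsmall
  obtain ⟨n, hn⟩ := (hbig.eventually_const_lt (u := 1/12) (by norm_num)).exists
  obtain ⟨l, hl⟩ := (hsmall.eventually_lt_const (u := 1/12) (by simp)).exists
  have hpre : IsPreconnected (Set.Ici 1 ×ˢ Set.Ici 1 : Set (ℝ × ℝ)) :=
    isPreconnected_Ici.prod isPreconnected_Ici
  obtain ⟨p, hp, hpv⟩ := hpre.intermediate_value (hmem 1 zero_lt_one le_rfl l) (hmem m hm0 hm1 n)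
    (blp_var_contOn Q hX) ⟨hl.le, hn.le⟩
  exact ⟨p.1, p.2, lt_of_lt_of_le zero_lt_one hp.1, lt_of_lt_of_le zero_lt_one hp.2, hpv⟩

/-- The beta-transformed linear pool is exchangeably flexibly
dispersive relative to the class `C_I⁺`: for continuous cumulative distribution
functions `F₀, F₁, …, F_k` supported in an interval `I` and strictly increasing on `I`,
with the observation `Y ~ F₀`, there are `α, β > 0` such that the equally weighted
beta-transformed linear pool PIT `Z_{α,β} = B_{α,β}((1/k)·Σᵢ Fᵢ(Y))` is neutrally
dispersed: `Var(Z_{α,β}) = 1/12` (Gneiting–Ranjan). (Components are indexed by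
`0, …, k−1` here.) -/
theorem blp_exchangeably_flexibly_dispersive
    {Ω : Type*} [MeasurableSpace Ω] (Q : Measure Ω) [IsProbabilityMeasure Q]
    (I : Set ℝ) (hI : I.OrdConnected)
    (k : ℕ) (hk : 1 ≤ k)
    (μ0 : Measure ℝ) [IsProbabilityMeasure μ0]
    (F0 : ℝ → ℝ) (hF0 : F0 = cdfOf μ0) (hF0cont : Continuous F0)
    (hsupp0 : μ0 Iᶜ = 0) (hF0mono : StrictMonoOn F0 I)
    (μc : ℕ → Measure ℝ) (hprob : ∀ i < k, IsProbabilityMeasure (μc i))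
    (F : ℕ → ℝ → ℝ) (hF : ∀ i < k, F i = cdfOf (μc i))
    (hFcont : ∀ i < k, Continuous (F i))
    (hsupp : ∀ i < k, μc i Iᶜ = 0)
    (hFmono : ∀ i < k, StrictMonoOn (F i) I)
    (Y : Ω → ℝ) (hYmeas : Measurable Y) (hYlaw : Q.map Y = μ0) :
    ∃ a b : ℝ, 0 < a ∧ 0 < b ∧
      variance
        (fun ω => betaCDF a b ((1 / (k : ℝ)) * ∑ i ∈ Finset.range k, F i (Y ω))) Q
        = 1 / 12 := by
  have hcdf0 : ∀ y, F0 y = cdf μ0 y := fun y => by rw [hF0, cdf_eq_real]; rfl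
  have hk' : (0:ℝ) < k := by exact_mod_cast hk
  set H : ℝ → ℝ := fun y => (1 / (k : ℝ)) * ∑ i ∈ Finset.range k, F i y with hH
  have hFm : ∀ i < k, Monotone (F i) := by
    intro i hi x y hxy
    have := hprob i hi
    rw [hF i hi]
    exact ENNReal.toReal_mono (measure_ne_top _ _) (measure_mono (Set.Iic_subset_Iic.2 hxy))
  have hF01 : ∀ i < k, ∀ y, F i y ∈ Set.Icc (0:ℝ) 1 := by
    intro i hi y
    have := hprob i hi
    rw [hF i hi]
    exact ⟨ENNReal.toReal_nonneg, measureReal_le_one (μ := μc i)⟩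
  have hHcont : Continuous H := by
    refine continuous_const.mul (continuous_finset_sum _ fun i hi => hFcont i (Finset.mem_range.1 hi))
  have hHmono : Monotone H := by
    intro x y hxy
    exact mul_le_mul_of_nonneg_left (Finset.sum_le_sum fun i hi => hFm i (Finset.mem_range.1 hi) hxy)
      (by positivity)
  have hH01 : ∀ y, H y ∈ Set.Icc (0:ℝ) 1 := by
    intro y
    constructor
    · exact mul_nonneg (by positivity)
        (Finset.sum_nonneg fun i hi => (hF01 i (Finset.mem_range.1 hi) y).1)
    · have : ∑ i ∈ Finset.range k, F i y ≤ k := by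
        have := Finset.sum_le_sum (s := Finset.range k) (f := fun i => F i y) (g := fun _ => (1:ℝ))
          fun i hi => (hF01 i (Finset.mem_range.1 hi) y).2
        simpa using this
      simp only [hH]
      rw [one_div, inv_mul_le_iff₀ hk']
      simpa using this
  have hHstrict : StrictMonoOn H I := by
    intro x hx y hy hxy
    refine mul_lt_mul_of_pos_left (Finset.sum_lt_sum_of_nonempty
      (Finset.nonempty_range_iff.2 (by omega)) fun i hi =>
      hFmono i (Finset.mem_range.1 hi) hx hy hxy) (by positivity)
  have hsing : ∀ c : ℝ, μ0 {c} = 0 := by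
    intro c
    have hc : ContinuousAt (cdf μ0) c := by
      have : (fun y => cdf μ0 y) = F0 := funext fun y => (hcdf0 y).symm
      exact (show Continuous (fun y => cdf μ0 y) from this ▸ hF0cont).continuousAt
    have h := (cdf μ0).measure_singleton c
    rw [measure_cdf, leftLim_eq_of_tendsto (hc.tendsto.mono_left nhdsWithin_le_nhds)] at h
    simpa using h
  have hatom0 : ∀ c, ∀ᵐ y ∂μ0, H y ≠ c := by
    intro c
    have hsub : ({y | H y = c} ∩ I).Subsingleton := by
      intro x hx y hy
      exact hHstrict.injOn hx.2 hy.2 (hx.1.trans hy.1.symm)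
    have h0 : μ0 ({y | H y = c} ∩ I) = 0 := by
      rcases hsub.eq_empty_or_singleton with h | ⟨z, h⟩
      · simp [h]
      · rw [h, hsing]
    have : {y | ¬ H y ≠ c} ⊆ ({y | H y = c} ∩ I) ∪ Iᶜ := by
      intro y hy
      by_cases hyI : y ∈ I
      · exact Or.inl ⟨not_not.1 hy, hyI⟩
      · exact Or.inr hyI
    exact measure_mono_null this (measure_union_null h0 hsupp0)
  have hatom : ∀ c, ∀ᵐ ω ∂Q, H (Y ω) ≠ c := by
    intro c
    have := hatom0 c
    rw [← hYlaw] at this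
    exact ae_of_ae_map hYmeas.aemeasurable this
  -- the median
  obtain ⟨y0, hy0⟩ : ∃ y0, F0 y0 = 1 / 2 := by
    have hb : Tendsto F0 atBot (𝓝 0) := (tendsto_cdf_atBot μ0).congr fun y => (hcdf0 y).symm
    have ht : Tendsto F0 atTop (𝓝 1) := (tendsto_cdf_atTop μ0).congr fun y => (hcdf0 y).symm
    obtain ⟨u, hu⟩ := (hb.eventually_lt_const (u := 1/2) (by norm_num)).exists
    obtain ⟨v, hv⟩ := (ht.eventually_const_lt (u := 1/2) (by norm_num)).exists
    exact mem_range_of_exists_le_of_exists_ge hF0cont ⟨u, hu.le⟩ ⟨v, hv.le⟩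
  have hlow : μ0.real (Set.Iic y0) = 1 / 2 := by rw [← hy0, hF0]; rfl
  have hup : μ0.real {y | H y0 < H y} = 1 / 2 := by
    have e : μ0.real {y | H y0 < H y} = μ0.real (Set.Iic y0)ᶜ := by
      apply measureReal_congr
      filter_upwards [hatom0 (H y0)] with y hy
      apply propext
      change H y0 < H y ↔ ¬ (y ≤ y0)
      constructor
      · intro h h'
        exact absurd (hHmono h') (not_le.2 h)
      · intro h
        exact lt_of_le_of_ne (hHmono (not_le.1 h).le) hy.symm
    rw [e, probReal_compl_eq_one_sub measurableSet_Iic, hlow]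
    norm_num
  have hm0 : 0 < H y0 := by
    refine lt_of_le_of_ne (hH01 y0).1 fun h => ?_
    have hz : μ0 (Set.Iic y0) = 0 := by
      refine measure_mono_null (fun y hy => ?_) (hatom0 0)
      simp only [Set.mem_compl_iff, Set.mem_setOf_eq, not_not]
      exact le_antisymm ((hHmono hy).trans h.symm.le) (hH01 y).1
    rw [measureReal_def, hz] at hlow
    norm_num at hlow
  refine blp_core Q (X := fun ω => H (Y ω)) (hHcont.measurable.comp hYmeas) (fun ω => hH01 _) hatom
    hm0 (hH01 y0).2 ?_
  rw [← hup, ← hYlaw, map_measureReal_apply hYmeas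
    (measurableSet_lt measurable_const hHcont.measurable)]
  rfl
end

section
/- Let u ∈ (0,1), and for α, β > 0 let B_{α,β} denote the cumulative distribution function of the Beta distribution with parameters α and β. Then for every α > 0 there exists a unique β(α) > 0 such that B_{α,β(α)}(u) = 1/2; moreover, if u < 1/2 then β(α) > α, if u = 1/2 then β(α) = α, if u > 1/2 then β(α) < α, and β(α) → 0 as α → 0. -/
open MeasureTheory

noncomputable def bf (a b t : ℝ) : ℝ := t ^ (a - 1) * (1 - t) ^ (b - 1)

lemma bf_int01 {a b : ℝ} (ha : 0 < a) (hb : 0 < b) :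
    IntervalIntegrable (bf a b) volume 0 1 := by
  have h := Complex.betaIntegral_convergent (u := (a : ℂ)) (v := (b : ℂ)) (by simpa) (by simpa)
  rw [intervalIntegrable_iff_integrableOn_Ioc_of_le (by norm_num)] at h ⊢
  refine (Integrable.re h).congr ?_
  refine (ae_restrict_iff' measurableSet_Ioc).2 (Filter.Eventually.of_forall fun x hx => ?_)
  have e : ((x : ℂ) ^ ((a : ℂ) - 1) * (1 - (x : ℂ)) ^ ((b : ℂ) - 1)) = ((bf a b x : ℝ) : ℂ) := by
    unfold bf
    push_cast
    rw [Complex.ofReal_cpow hx.1.le, Complex.ofReal_cpow (by linarith [hx.2])]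
    push_cast
    rfl
  change RCLike.re ((x : ℂ) ^ ((a : ℂ) - 1) * (1 - (x : ℂ)) ^ ((b : ℂ) - 1)) = bf a b x
  rw [e]
  simp

lemma bf_int {a b x y : ℝ} (ha : 0 < a) (hb : 0 < b) (hx : x ∈ Set.Icc (0:ℝ) 1)
    (hy : y ∈ Set.Icc (0:ℝ) 1) : IntervalIntegrable (bf a b) volume x y := by
  refine (bf_int01 ha hb).mono_set ?_
  rw [Set.uIcc_of_le (zero_le_one' ℝ)]
  exact Set.uIcc_subset_Icc hx hy

lemma bf_pos {a b t : ℝ} (h0 : 0 < t) (h1 : t < 1) : 0 < bf a b t :=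
  mul_pos (Real.rpow_pos_of_pos h0 _) (Real.rpow_pos_of_pos (by linarith) _)

noncomputable def J (a b x y : ℝ) : ℝ := ∫ t in x..y, bf a b t

lemma J_pos {a b x y : ℝ} (ha : 0 < a) (hb : 0 < b) (hx : 0 ≤ x) (hxy : x < y) (hy : y ≤ 1) :
    0 < J a b x y :=
  intervalIntegral.intervalIntegral_pos_of_pos_on
    (bf_int ha hb ⟨hx, by linarith⟩ ⟨by linarith, hy⟩)
    (fun t ht => bf_pos (by linarith [ht.1]) (by linarith [ht.2])) hxy

lemma J_add {a b x y z : ℝ} (ha : 0 < a) (hb : 0 < b) (hx : x ∈ Set.Icc (0:ℝ) 1)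
    (hy : y ∈ Set.Icc (0:ℝ) 1) (hz : z ∈ Set.Icc (0:ℝ) 1) :
    J a b x y + J a b y z = J a b x z :=
  intervalIntegral.integral_add_adjacent_intervals (bf_int ha hb hx hy) (bf_int ha hb hy hz)

lemma J_symm (a b x y : ℝ) : J a b x y = J b a (1 - y) (1 - x) := by
  unfold J
  rw [← intervalIntegral.integral_comp_sub_left (fun t => bf b a t) 1]
  congr 1
  ext t
  unfold bf
  rw [mul_comm]
  simp

lemma cdf_iff {a b u : ℝ} (ha : 0 < a) (hb : 0 < b) (hu : u ∈ Set.Ioo (0:ℝ) 1) :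
    betaCDF a b u = 1 / 2 ↔ J a b 0 u = J a b u 1 := by
  have h0 := J_pos ha hb le_rfl hu.1 hu.2.le
  have h1 := J_pos ha hb hu.1.le hu.2 le_rfl
  have h2 := J_add (x := 0) (y := u) (z := 1) ha hb (by simp) ⟨hu.1.le, hu.2.le⟩ (by simp)
  have e : betaCDF a b u = J a b 0 u / J a b 0 1 := by
    unfold betaCDF J
    rw [min_eq_left hu.2.le, intervalIntegral.integral_of_le hu.1.le,
      intervalIntegral.integral_of_le (zero_le_one' ℝ)]
    rfl
  rw [e, ← h2, div_eq_div_iff (by positivity) (by norm_num)]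
  constructor <;> intro h <;> linarith

lemma bf_shift {a b d t : ℝ} (h1 : t < 1) : bf a (b + d) t = (1 - t) ^ d * bf a b t := by
  unfold bf
  rw [show b + d - 1 = d + (b - 1) by ring, Real.rpow_add (by linarith)]
  ring

lemma J_lower {a b d x y : ℝ} (ha : 0 < a) (hb : 0 < b) (hd : 0 < d) (hx : 0 ≤ x) (hxy : x < y)
    (hy : y ≤ 1) : (1 - y) ^ d * J a b x y < J a (b + d) x y := by
  have i1 := bf_int (b := b) ha hb ⟨hx, by linarith⟩ ⟨by linarith, hy⟩
  have i2 := bf_int (b := b + d) ha (by linarith) ⟨hx, by linarith⟩ ⟨by linarith, hy⟩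
  have := intervalIntegral.intervalIntegral_pos_of_pos_on
    (i2.sub (i1.const_mul ((1 - y) ^ d))) (fun t ht => by
      rw [bf_shift (by linarith [ht.2]), ← sub_mul]
      refine mul_pos (sub_pos.2 ?_) (bf_pos (by linarith [ht.1]) (by linarith [ht.2]))
      exact Real.rpow_lt_rpow (by linarith) (by linarith [ht.2]) hd) hxy
  rw [intervalIntegral.integral_sub i2 (i1.const_mul _), intervalIntegral.integral_const_mul] at this
  unfold J
  linarith

lemma J_upper {a b d x y : ℝ} (ha : 0 < a) (hb : 0 < b) (hd : 0 < d) (hx : 0 ≤ x) (hxy : x < y)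
    (hy : y ≤ 1) : J a (b + d) x y < (1 - x) ^ d * J a b x y := by
  have i1 := bf_int (b := b) ha hb ⟨hx, by linarith⟩ ⟨by linarith, hy⟩
  have i2 := bf_int (b := b + d) ha (by linarith) ⟨hx, by linarith⟩ ⟨by linarith, hy⟩
  have := intervalIntegral.intervalIntegral_pos_of_pos_on
    ((i1.const_mul ((1 - x) ^ d)).sub i2) (fun t ht => by
      rw [bf_shift (by linarith [ht.2]), ← sub_mul]
      refine mul_pos (sub_pos.2 ?_) (bf_pos (by linarith [ht.1]) (by linarith [ht.2]))
      exact Real.rpow_lt_rpow (by linarith [ht.2]) (by linarith [ht.1]) hd) hxy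
  rw [intervalIntegral.integral_sub (i1.const_mul _) i2, intervalIntegral.integral_const_mul] at this
  unfold J
  linarith

lemma strict_step {a b b' u : ℝ} (ha : 0 < a) (hb : 0 < b) (hu : u ∈ Set.Ioo (0:ℝ) 1)
    (hbb : b < b') (h : J a b u 1 ≤ J a b 0 u) : J a b' u 1 < J a b' 0 u := by
  have h1 := J_lower (d := b' - b) ha hb (by linarith) le_rfl hu.1 hu.2.le
  have h2 := J_upper (d := b' - b) ha hb (by linarith) hu.1.le hu.2 le_rfl
  rw [add_sub_cancel] at h1 h2
  have := mul_le_mul_of_nonneg_left h (Real.rpow_nonneg (by linarith [hu.2] : 0 ≤ 1 - u) (b' - b))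
  linarith

lemma small_left {a b u : ℝ} (ha : 0 < a) (hb : 0 < b) (hu : u ∈ Set.Ioo (0:ℝ) 1)
    (ha1 : a ≤ 1) (hab : a < u ^ 2 * b) : J a b u 1 < J a b 0 u := by
  obtain ⟨h0, h1⟩ := hu
  have hL : (1 - u) ^ b * (u ^ a / a) ≤ J a b 0 u := by
    have e : (∫ t in (0:ℝ)..u, (1 - u) ^ b * t ^ (a - 1)) = (1 - u) ^ b * (u ^ a / a) := by
      rw [intervalIntegral.integral_const_mul, integral_rpow (Or.inl (by linarith))]
      simp [Real.zero_rpow ha.ne']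
    rw [← e]
    refine intervalIntegral.integral_mono_on_of_le_Ioo h0.le
      ((intervalIntegral.intervalIntegrable_rpow' (by linarith)).const_mul _)
      (bf_int ha hb (by simp) ⟨h0.le, h1.le⟩) fun t ht => ?_
    unfold bf
    rw [mul_comm]
    refine mul_le_mul_of_nonneg_left ?_ (Real.rpow_nonneg ht.1.le _)
    calc (1 - u) ^ b ≤ (1 - t) ^ b := Real.rpow_le_rpow (by linarith) (by linarith [ht.2]) hb.le
      _ ≤ (1 - t) ^ (b - 1) := Real.rpow_le_rpow_of_exponent_ge (by linarith [ht.2])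
          (by linarith [ht.1]) (by linarith)
  have hR : J a b u 1 ≤ u⁻¹ * ((1 - u) ^ b / b) := by
    have e : (∫ t in u..1, u⁻¹ * (1 - t) ^ (b - 1)) = u⁻¹ * ((1 - u) ^ b / b) := by
      rw [intervalIntegral.integral_const_mul,
        intervalIntegral.integral_comp_sub_left (fun t => t ^ (b - 1)) 1,
        integral_rpow (Or.inl (by linarith))]
      simp [Real.zero_rpow hb.ne']
    rw [← e]
    have ii : IntervalIntegrable (fun t : ℝ => (1 - t) ^ (b - 1)) volume u 1 := by
      have := (bf_int (a := 1) (b := b) one_pos hb ⟨h0.le, h1.le⟩ (y := 1) (by simp))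
      refine this.congr fun t _ => ?_
      simp [bf]
    refine intervalIntegral.integral_mono_on_of_le_Ioo h1.le
      (bf_int ha hb ⟨h0.le, h1.le⟩ (by simp)) (ii.const_mul _) fun t ht => ?_
    unfold bf
    have ht0 : 0 < t := h0.trans ht.1
    refine mul_le_mul_of_nonneg_right ?_ (Real.rpow_nonneg (by linarith [ht.2]) _)
    rw [Real.rpow_sub_one ht0.ne', div_eq_mul_inv]
    have q1 : t ^ a ≤ 1 := Real.rpow_le_one ht0.le ht.2.le ha.le
    have q2 : t⁻¹ ≤ u⁻¹ := inv_anti₀ h0 ht.1.le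
    have := inv_pos.2 ht0
    nlinarith
  refine hR.trans_lt (lt_of_lt_of_le ?_ hL)
  have hc : 0 < (1 - u) ^ b := Real.rpow_pos_of_pos (by linarith) _
  have hua : u ≤ u ^ a := by
    simpa using Real.rpow_le_rpow_of_exponent_ge h0 h1.le ha1
  have : u⁻¹ * b⁻¹ < u / a := by
    rw [← mul_inv, inv_lt_iff_one_lt_mul₀ (by positivity), div_mul_eq_mul_div,
      one_lt_div ha]
    nlinarith
  calc u⁻¹ * ((1 - u) ^ b / b) = (1 - u) ^ b * (u⁻¹ * b⁻¹) := by ring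
    _ < (1 - u) ^ b * (u / a) := by gcongr
    _ ≤ _ := by gcongr

lemma small_right {a b u : ℝ} (ha : 0 < a) (hb : 0 < b) (hu : u ∈ Set.Ioo (0:ℝ) 1)
    (hb1 : b ≤ 1) (hab : b < (1 - u) ^ 2 * a) : J a b 0 u < J a b u 1 := by
  have := small_left (u := 1 - u) hb ha ⟨by linarith [hu.2], by linarith [hu.1]⟩ hb1 hab
  rw [J_symm a b 0 u, J_symm a b u 1]
  simpa using this

lemma large_b {a u : ℝ} (ha : 0 < a) (hu : u ∈ Set.Ioo (0:ℝ) 1) :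
    ∃ b, 0 < b ∧ J a b u 1 < J a b 0 u := by
  obtain ⟨h0, h1⟩ := hu
  have hK : 0 < J a 1 0 (u / 2) := J_pos ha one_pos le_rfl (by linarith) (by linarith)
  have hR : 0 < J a 1 u 1 := J_pos ha one_pos h0.le h1 le_rfl
  have hr : (1 - u) / (1 - u / 2) < 1 := by rw [div_lt_one] <;> linarith
  have hr0 : 0 ≤ (1 - u) / (1 - u / 2) := div_nonneg (by linarith) (by linarith)
  obtain ⟨n, hn⟩ := exists_pow_lt_of_lt_one (div_pos hK hR) hr
  have hn' : ((1 - u) / (1 - u / 2)) ^ (n + 1) < J a 1 0 (u / 2) / J a 1 u 1 :=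
    lt_of_le_of_lt (pow_le_pow_of_le_one hr0 hr.le (Nat.le_succ n)) hn
  have hd : (0:ℝ) < ((n + 1 : ℕ) : ℝ) := by positivity
  refine ⟨1 + ((n + 1 : ℕ) : ℝ), by positivity, ?_⟩
  have e1 := J_lower (d := ((n + 1 : ℕ) : ℝ)) ha one_pos hd le_rfl (by linarith : 0 < u / 2)
    (by linarith)
  have e2 := J_upper (d := ((n + 1 : ℕ) : ℝ)) ha one_pos hd h0.le h1 le_rfl
  have e3 := J_add (b := 1 + ((n + 1 : ℕ) : ℝ)) (x := 0) (y := u / 2) (z := u) ha (by positivity)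
    (by simp) ⟨by linarith, by linarith⟩ ⟨by linarith, by linarith⟩
  have e4 := J_pos (b := 1 + ((n + 1 : ℕ) : ℝ)) (x := u / 2) (y := u) ha (by positivity)
    (by linarith) (by linarith) (by linarith)
  rw [Real.rpow_natCast] at e1 e2
  rw [div_pow, div_lt_div_iff₀ (pow_pos (by linarith) _) hR] at hn'
  linarith

lemma J_cont {a x y : ℝ} (ha : 0 < a) (hx : 0 ≤ x) (hxy : x ≤ y) (hy : y ≤ 1) :
    ContinuousOn (fun b => J a b x y) (Set.Ioi 0) := by
  intro b hb
  have hb : 0 < b := hb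
  refine ContinuousAt.continuousWithinAt ?_
  unfold J
  have hne : ∀ᵐ t : ℝ, t ≠ 1 := by
    simp [ae_iff, measure_singleton]
  refine intervalIntegral.continuousAt_of_dominated_interval (bound := bf a (b / 2)) ?_ ?_ ?_ ?_
  · filter_upwards [Ioi_mem_nhds hb] with c hc
    have hi := bf_int ha hc ⟨hx, by linarith⟩ ⟨by linarith, hy⟩
    exact (intervalIntegrable_iff.1 hi).aestronglyMeasurable
  · filter_upwards [Ioi_mem_nhds (half_lt_self hb)] with c hc
    filter_upwards [hne] with t ht htm
    rw [Set.uIoc_of_le hxy] at htm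
    have t0 : 0 < t := by linarith [htm.1]
    have t1 : t < 1 := lt_of_le_of_ne (by linarith [htm.2]) ht
    rw [Real.norm_of_nonneg (bf_pos t0 t1).le]
    refine mul_le_mul_of_nonneg_left ?_ (Real.rpow_nonneg t0.le _)
    have hc : b / 2 < c := hc
    exact Real.rpow_le_rpow_of_exponent_ge (by linarith) (by linarith) (by linarith)
  · exact bf_int ha (by linarith) ⟨hx, by linarith⟩ ⟨by linarith, hy⟩
  · filter_upwards [hne] with t ht htm
    rw [Set.uIoc_of_le hxy] at htm
    have t1 : t < 1 := lt_of_le_of_ne (by linarith [htm.2]) ht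
    unfold bf
    have : 0 < 1 - t := by linarith
    exact continuousAt_const.mul
      (ContinuousAt.rpow continuousAt_const (by fun_prop) (Or.inl this.ne'))

lemma exists_b {a u : ℝ} (ha : 0 < a) (hu : u ∈ Set.Ioo (0:ℝ) 1) :
    ∃ b, 0 < b ∧ J a b 0 u = J a b u 1 := by
  obtain ⟨b1, hb1, h1⟩ := large_b ha hu
  have hq : 0 < (1 - u) ^ 2 * a := mul_pos (pow_pos (by linarith [hu.2]) _) ha
  set b0 := min 1 ((1 - u) ^ 2 * a / 2) with hb0
  have hb0p : 0 < b0 := lt_min one_pos (by linarith)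
  have h0 := small_right ha hb0p hu (min_le_left _ _)
    (lt_of_le_of_lt (min_le_right _ _) (half_lt_self hq))
  have hc : ContinuousOn (fun b => J a b 0 u - J a b u 1) (Set.Ioi 0) :=
    (J_cont ha le_rfl hu.1.le hu.2.le).sub (J_cont ha hu.1.le hu.2.le le_rfl)
  obtain ⟨b, hb, hbe⟩ := isPreconnected_Ioi.intermediate_value (Set.mem_Ioi.2 hb0p)
    (Set.mem_Ioi.2 hb1) hc (show (0:ℝ) ∈ Set.Icc _ _ from ⟨by linarith, by linarith⟩)
  exact ⟨b, hb, by simpa [sub_eq_zero] using hbe⟩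

lemma lt_of_pos {a b c u : ℝ} (ha : 0 < a) (hc : 0 < c) (hu : u ∈ Set.Ioo (0:ℝ) 1)
    (hbe : J a b 0 u = J a b u 1) (h : J a c u 1 < J a c 0 u) : b < c := by
  rcases lt_trichotomy b c with h' | h' | h'
  · exact h'
  · subst h'; linarith
  · linarith [strict_step ha hc hu h' h.le]

lemma lt_of_neg {a b c u : ℝ} (ha : 0 < a) (hb : 0 < b) (hu : u ∈ Set.Ioo (0:ℝ) 1)
    (hbe : J a b 0 u = J a b u 1) (h : J a c 0 u < J a c u 1) : c < b := by
  rcases lt_trichotomy c b with h' | h' | h'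
  · exact h'
  · subst h'; linarith
  · linarith [strict_step ha hb hu h' hbe.ge]

lemma uniq_b {a b c u : ℝ} (ha : 0 < a) (hb : 0 < b) (hc : 0 < c) (hu : u ∈ Set.Ioo (0:ℝ) 1)
    (hbe : J a b 0 u = J a b u 1) (hce : J a c 0 u = J a c u 1) : b = c := by
  rcases lt_trichotomy b c with h' | h' | h'
  · linarith [strict_step ha hb hu h' hbe.ge]
  · exact h'
  · linarith [strict_step ha hc hu h' hce.ge]

/-- **key lemma for Proposition 9 of Gneiting–Ranjan.** For fixed
`u ∈ (0,1)`, for every `α > 0` there is a unique `β(α) > 0` with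
`B_{α,β(α)}(u) = 1/2`; moreover `β(α) > α` if `u < 1/2`, `β(α) = α` if `u = 1/2`,
`β(α) < α` if `u > 1/2`, and `β(α) → 0` as `α → 0⁺`. -/
theorem beta_median_matching
    (u : ℝ) (hu : u ∈ Set.Ioo (0 : ℝ) 1) :
    ∃ bfun : ℝ → ℝ,
      (∀ a, 0 < a →
        0 < bfun a ∧ betaCDF a (bfun a) u = 1 / 2 ∧
          ∀ b, 0 < b → betaCDF a b u = 1 / 2 → b = bfun a) ∧
      (u < 1 / 2 → ∀ a, 0 < a → a < bfun a) ∧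
      (u = 1 / 2 → ∀ a, 0 < a → bfun a = a) ∧
      (1 / 2 < u → ∀ a, 0 < a → bfun a < a) ∧
      Filter.Tendsto bfun (nhdsWithin 0 (Set.Ioi 0)) (nhds 0) := by
  choose! g hg using fun a (ha : 0 < a) => exists_b ha hu
  have hs : ∀ a, J a a u 1 = J a a 0 (1 - u) := fun a => by rw [J_symm]; simp
  obtain ⟨h0, h1⟩ := hu
  have hu : u ∈ Set.Ioo (0:ℝ) 1 := ⟨h0, h1⟩
  refine ⟨g, fun a ha => ⟨(hg a ha).1, (cdf_iff ha (hg a ha).1 hu).2 (hg a ha).2,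
    fun b hb h => uniq_b ha hb (hg a ha).1 hu ((cdf_iff ha hb hu).1 h) (hg a ha).2⟩,
    fun h a ha => ?_, fun h a ha => ?_, fun h a ha => ?_, ?_⟩
  · refine lt_of_neg ha (hg a ha).1 hu (hg a ha).2 ?_
    rw [hs, ← J_add (x := 0) (y := u) (z := 1 - u) ha ha (by simp) ⟨h0.le, h1.le⟩
      ⟨by linarith, by linarith⟩]
    linarith [J_pos (x := u) (y := 1 - u) ha ha (by linarith) (by linarith) (by linarith)]
  · refine uniq_b ha (hg a ha).1 ha hu (hg a ha).2 ?_
    rw [hs, h]; norm_num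
  · refine lt_of_pos ha ha hu (hg a ha).2 ?_
    rw [hs, ← J_add (x := 0) (y := 1 - u) (z := u) ha ha (by simp)
      ⟨by linarith, by linarith⟩ ⟨h0.le, h1.le⟩]
    linarith [J_pos (x := 1 - u) (y := u) ha ha (by linarith) (by linarith) (by linarith)]
  · rw [Metric.tendsto_nhds]
    intro e he
    have hd : 0 < min 1 (u ^ 2 * e) := lt_min one_pos (by positivity)
    filter_upwards [Ioo_mem_nhdsGT hd] with a ha
    have := lt_of_pos ha.1 he hu (hg a ha.1).2
      (small_left ha.1 he hu (ha.2.le.trans (min_le_left _ _))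
        (ha.2.trans_le (min_le_right _ _)))
    rw [Real.dist_eq, sub_zero, abs_of_pos (hg a ha.1).1]
    exact this
end
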